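/- arXiv:1705.05979 — 6 statements merged into one kernel-verified Lean document; each statement's English description precedes it below -/
import Mathlib

section
/- Let k be a perfect field of characteristic p > 0 and let n ≥ 2 be an integer. Let V₁, …, V_m be finite-dimensional k-subspaces of the quotient k-vector space k[x₁,…,x_n] / k[x₁^p,…,x_n^p]. Then there exists a polynomial g ∈ k[x₁,…,x_{n−1}] such that the k-linear map k[x₁,…,x_n]/k[x₁^p,…,x_n^p] → k[x₁,…,x_{n−1}]/k[x₁^p,…,x_{n−1}^p] induced by the substitution homomorphism x_i ↦ x_i for 1 ≤ i ≤ n−1 and x_n ↦ g restricts to an injective map on each of the subspaces V₁, …, V_m. -/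
open MvPolynomial

/-- The `k`-submodule `k[x₁^p, …, x_N^p]` of the polynomial ring `k[x₁, …, x_N]`,
i.e. the subalgebra generated by the `p`-th powers of the variables, viewed as a
`k`-subspace. -/
noncomputable def frobeniusSubmodule (k : Type*) [CommRing k] (p N : ℕ) :
    Submodule k (MvPolynomial (Fin N) k) :=
  Subalgebra.toSubmodule
    (Algebra.adjoin k (Set.range fun i : Fin N => (X i : MvPolynomial (Fin N) k) ^ p))

/-- The substitution homomorphism `k[x₁, …, x_{N+1}] → k[x₁, …, x_N]` sending
`x_i ↦ x_i` for `i ≤ N` and the last variable to `g`. -/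
noncomputable def substLast {k : Type*} [CommRing k] {N : ℕ} (g : MvPolynomial (Fin N) k) :
    MvPolynomial (Fin (N + 1)) k →ₐ[k] MvPolynomial (Fin N) k :=
  aeval (Fin.snoc (fun i : Fin N => (X i : MvPolynomial (Fin N) k)) g)

section helpers

theorem aux_deriv {k A : Type*} [CommRing k] [CommRing A] [Algebra k A] (d : Derivation k A A) (g : A)
    (Q : Polynomial A) : ∃ P : Polynomial A,
      (∀ b, P.coeff b = d (Q.coeff b) + (b + 1) * Q.coeff (b + 1) * d g) ∧
      P.eval g = d (Q.eval g) := by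
  induction Q using Polynomial.induction_on' with
  | add Q R hQ hR =>
    obtain ⟨P, h1, h2⟩ := hQ
    obtain ⟨P', h1', h2'⟩ := hR
    refine ⟨P + P', fun b => ?_, by simp [h2, h2']⟩
    simp only [Polynomial.coeff_add, h1, h1', map_add]
    ring
  | monomial m c =>
    refine ⟨Polynomial.monomial m (d c) + Polynomial.C (d g) * Polynomial.derivative (Polynomial.monomial m c),
      fun b => ?_, ?_⟩
    · simp only [Polynomial.coeff_add, Polynomial.coeff_C_mul, Polynomial.coeff_derivative,
        Polynomial.coeff_monomial]
      split_ifs <;> simp <;> ring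
    · simp only [Polynomial.eval_add, Polynomial.eval_mul, Polynomial.eval_C,
        Polynomial.derivative_monomial, Polynomial.eval_monomial, Derivation.leibniz,
        Derivation.leibniz_pow, smul_eq_mul, nsmul_eq_mul]
      ring

theorem aux_zero {k : Type*} [Field k] {n : ℕ} (i : Fin n) (g : MvPolynomial (Fin n) k) :
    ∀ (N : ℕ) (Q : Polynomial (MvPolynomial (Fin n) k)), Q.natDegree < N →
      (∀ b, degreeOf i (Q.coeff b) < degreeOf i g) → Q.eval g = 0 → Q = 0 := by
  intro N
  induction N with
  | zero => intro Q h; omega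
  | succ N ih =>
    intro Q hN hd h0
    have hg : g ≠ 0 := by
      rintro rfl
      simpa using hd 0
    have h1 := Polynomial.divX_mul_X_add Q
    have h2 : (Q.divX).eval g = 0 := by
      by_contra hne
      have h3 : Q.coeff 0 = - (Q.divX.eval g * g) := by
        rw [← h1] at h0
        simp only [Polynomial.eval_add, Polynomial.eval_mul, Polynomial.eval_X,
          Polynomial.eval_C] at h0
        linear_combination h0
      have h4 := hd 0
      rw [h3, degreeOf_neg, degreeOf_mul_eq hne hg] at h4
      omega
    have h5 : Q.coeff 0 = 0 := by
      rw [← h1] at h0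
      simpa [h2] using h0
    by_cases hq : Q.natDegree = 0
    · rw [Polynomial.eq_C_of_natDegree_eq_zero hq, h5, map_zero]
    have h6 : Q.divX = 0 := by
      apply ih
      · rw [Polynomial.natDegree_divX_eq_natDegree_tsub_one]; omega
      · intro b; rw [Polynomial.coeff_divX]; exact hd _
      · exact h2
    rw [← h1, h6, h5]; simp

theorem aux_pderiv_zero {k : Type*} [Field k] {p : ℕ} [CharP k p] {n : ℕ}
    (c : MvPolynomial (Fin n) k) (hc : c ∈ frobeniusSubmodule k p n) (i : Fin n) :
    pderiv i c = 0 := by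
  have hc' : c ∈ Algebra.adjoin k (Set.range fun i : Fin n => (X i : MvPolynomial (Fin n) k) ^ p) := hc
  induction hc' using Algebra.adjoin_induction with
  | mem x hx =>
    obtain ⟨j, rfl⟩ := hx
    simp [pderiv_pow]
  | algebraMap r => exact pderiv_C
  | add x y hx hy h1 h2 => rw [map_add, h1 hx, h2 hy, add_zero]
  | mul x y hx hy h1 h2 => rw [pderiv_mul, h1 hx, h2 hy]; simp

theorem aux_mem {k : Type*} [Field k] {p : ℕ} [CharP k p] {n : ℕ}
    (c : MvPolynomial (Fin n) k) (h : ∀ i, pderiv i c = 0) : c ∈ frobeniusSubmodule k p n := by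
  rw [c.as_sum]
  refine Submodule.sum_mem _ fun m hm => ?_
  have hdiv : ∀ i, p ∣ m i := by
    intro i
    by_cases hmi : m i = 0
    · simp [hmi]
    have h1 := congrArg (coeff (m - Finsupp.single i 1)) (h i)
    have h2 : m - Finsupp.single i 1 + Finsupp.single i 1 = m := by
      ext j
      by_cases hj : i = j
      · subst hj; simp; omega
      · simp [Finsupp.single_apply, hj]
    have h3 : (m - Finsupp.single i 1 : Fin n →₀ ℕ) i + 1 = m i := by
      simp; omega
    rw [coeff_pderiv, h2] at h1
    have h4 : ((m i : ℕ) : k) = 0 := by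
      rw [← h3]
      rcases mul_eq_zero.1 h1 with h | h
      · exact absurd h (mem_support_iff.1 hm)
      · exact_mod_cast h
    exact (CharP.cast_eq_zero_iff k p _).1 h4
  rw [monomial_eq]
  change _ ∈ Algebra.adjoin k _
  refine mul_mem (Subalgebra.algebraMap_mem _ _) ?_
  refine prod_mem fun i _ => ?_
  obtain ⟨q, hq⟩ := hdiv i
  rw [hq]
  change (X i : MvPolynomial (Fin n) k) ^ (p * q) ∈ _
  rw [pow_mul]
  exact pow_mem (Algebra.subset_adjoin (Set.mem_range_self i)) _

noncomputable def auxPhi (k : Type*) [Field k] (n : ℕ) :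
    MvPolynomial (Fin (n + 1)) k →ₐ[k] Polynomial (MvPolynomial (Fin n) k) :=
  aeval (Fin.snoc (fun i : Fin n => Polynomial.C (X i : MvPolynomial (Fin n) k)) Polynomial.X)

theorem aux_subst {k : Type*} [Field k] {n : ℕ} (g : MvPolynomial (Fin n) k)
    (f : MvPolynomial (Fin (n + 1)) k) : substLast g f = (auxPhi k n f).eval g := by
  have : substLast g = ((Polynomial.aeval g : Polynomial (MvPolynomial (Fin n) k) →ₐ[MvPolynomial (Fin n) k] _).restrictScalars k).comp (auxPhi k n) := by
    apply MvPolynomial.algHom_ext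
    intro i
    refine Fin.lastCases ?_ (fun i => ?_) i <;> simp [substLast, auxPhi]
  rw [this]
  simp [Polynomial.aeval_def, Polynomial.eval₂_eq_eval_map]

theorem aux_psi {k : Type*} [Field k] {n : ℕ} (f : MvPolynomial (Fin (n + 1)) k) :
    Polynomial.eval₂ (rename Fin.castSucc : MvPolynomial (Fin n) k →ₐ[k] _).toRingHom
      (X (Fin.last n)) (auxPhi k n f) = f := by
  induction f using MvPolynomial.induction_on with
  | C a =>
    have : auxPhi k n (C a) = Polynomial.C (C a) := by
      simp [auxPhi, algHom_C]
    rw [this]; simp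
  | add f g hf hg => rw [map_add, Polynomial.eval₂_add, hf, hg]
  | mul_X f i hf =>
    rw [map_mul, Polynomial.eval₂_mul, hf]
    congr 1
    refine Fin.lastCases ?_ (fun i => ?_) i <;> simp [auxPhi]

theorem aux_rename {k : Type*} [Field k] {p n : ℕ} (c : MvPolynomial (Fin n) k)
    (hc : c ∈ frobeniusSubmodule k p n) :
    rename Fin.castSucc c ∈ frobeniusSubmodule k p (n + 1) := by
  have : (Algebra.adjoin k (Set.range fun i : Fin n => (X i : MvPolynomial (Fin n) k) ^ p)) ≤
      (Algebra.adjoin k (Set.range fun i : Fin (n + 1) =>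
        (X i : MvPolynomial (Fin (n + 1)) k) ^ p)).comap (rename Fin.castSucc) := by
    rw [Algebra.adjoin_le_iff]
    rintro _ ⟨i, rfl⟩
    simp only [Subalgebra.coe_comap, Set.mem_preimage, map_pow, rename_X]
    exact Algebra.subset_adjoin ⟨i.castSucc, rfl⟩
  exact this hc

theorem aux_f_mem {k : Type*} [Field k] {p n : ℕ} [CharP k p] (f : MvPolynomial (Fin (n + 1)) k)
    (h1 : ∀ b, (auxPhi k n f).coeff b ∈ frobeniusSubmodule k p n)
    (h2 : ∀ b, ((b : ℕ) : MvPolynomial (Fin n) k) * (auxPhi k n f).coeff b = 0) :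
    f ∈ frobeniusSubmodule k p (n + 1) := by
  rw [← aux_psi f, Polynomial.eval₂_eq_sum, Polynomial.sum]
  refine Submodule.sum_mem _ fun b hb => ?_
  have hpb : p ∣ b := by
    rcases mul_eq_zero.1 (h2 b) with h | h
    · exact (CharP.cast_eq_zero_iff (MvPolynomial (Fin n) k) p _).1 h
    · exact absurd h (Polynomial.mem_support_iff.1 hb)
  obtain ⟨q, rfl⟩ := hpb
  have := aux_rename _ (h1 (p * q))
  change _ ∈ Algebra.adjoin k _
  refine mul_mem this ?_
  rw [pow_mul]
  exact pow_mem (Algebra.subset_adjoin (Set.mem_range_self (Fin.last n))) _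

noncomputable def auxB (k : Type*) [Field k] {n : ℕ} (i : Fin n) (D : ℕ) :
    Submodule k (MvPolynomial (Fin (n + 1)) k) where
  carrier := {f | ∀ b, degreeOf i ((auxPhi k n f).coeff b) ≤ D}
  add_mem' := by
    intro f g hf hg b
    rw [map_add, Polynomial.coeff_add]
    exact (degreeOf_add_le _ _ _).trans (max_le (hf b) (hg b))
  zero_mem' := by intro b; simp
  smul_mem' := by
    intro c f hf b
    rw [map_smul, Polynomial.coeff_smul, MvPolynomial.smul_eq_C_mul]
    exact (degreeOf_mul_le _ _ _).trans (by simpa using hf b)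

theorem auxB_exists {k : Type*} [Field k] {n : ℕ} (i : Fin n) (f : MvPolynomial (Fin (n + 1)) k) :
    ∃ D, f ∈ auxB k i D := by
  refine ⟨(auxPhi k n f).support.sup fun b => degreeOf i ((auxPhi k n f).coeff b), fun b => ?_⟩
  by_cases hb : b ∈ (auxPhi k n f).support
  · exact Finset.le_sup (f := fun b => degreeOf i ((auxPhi k n f).coeff b)) hb
  · rw [Polynomial.notMem_support_iff.1 hb]; simp

theorem auxB_mono {k : Type*} [Field k] {n : ℕ} (i : Fin n) {D E : ℕ} (h : D ≤ E) :
    auxB k i D ≤ auxB k i E := fun _ hf b => (hf b).trans h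

theorem aux_degree_pderiv {k : Type*} [Field k] {n : ℕ} (i j : Fin n) (c : MvPolynomial (Fin n) k) :
    degreeOf i (pderiv j c) ≤ degreeOf i c := by
  rw [degreeOf_le_iff]
  intro m hm
  rw [mem_support_iff, coeff_pderiv] at hm
  have := monomial_le_degreeOf i (mem_support_iff.2 (left_ne_zero_of_mul hm))
  refine le_trans ?_ this
  simp

theorem aux_main {k : Type*} [Field k] {p : ℕ} [hp : Fact p.Prime] [CharP k p]
    {n : ℕ} (i : Fin n) (D : ℕ) : ∃ g : MvPolynomial (Fin n) k, ∀ f ∈ auxB k i D,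
      substLast g f ∈ frobeniusSubmodule k p n → f ∈ frobeniusSubmodule k p (n + 1) := by
  have h2p := hp.out.two_le
  have hpD : 2 * (D + 1) ≤ p * (D + 1) := Nat.mul_le_mul_right _ h2p
  set e := p * (D + 1) with he
  let g : MvPolynomial (Fin n) k := X i ^ (p * (2 * (D + 1))) + X i ^ (e + 1)
  have h2e : p * (2 * (D + 1)) = 2 * e := by rw [he]; ring
  have hgd : 2 * e ≤ degreeOf i g := by
    have : Finsupp.single i (2 * e) ∈ g.support := by
      rw [mem_support_iff]
      simp only [g, h2e, coeff_add, coeff_X_pow]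
      have : Finsupp.single i (e + 1) ≠ Finsupp.single i (2 * e) := by
        intro h
        have := Finsupp.single_injective i h
        omega
      rw [if_pos trivial, if_neg this, add_zero]
      exact one_ne_zero
    simpa using monomial_le_degreeOf i this
  have hpe : ((e : ℕ) : MvPolynomial (Fin n) k) = 0 := by
    rw [he, Nat.cast_mul, CharP.cast_eq_zero, zero_mul]
  have hgi : pderiv i g = X i ^ e := by
    simp only [g, map_add, pderiv_pow, pderiv_X_self, h2e]
    push_cast
    rw [hpe]; simp
  have hgj : ∀ j, j ≠ i → pderiv j g = 0 := by
    intro j hj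
    simp [g, pderiv_pow, pderiv_X_of_ne hj.symm]
  have hXe : degreeOf i (X i ^ e : MvPolynomial (Fin n) k) = e := by
    rw [degreeOf_pow_eq _ _ _ (X_ne_zero i), degreeOf_X_self, mul_one]
  refine ⟨g, fun f hf hfg => ?_⟩
  rw [aux_subst] at hfg
  set Q := auxPhi k n f with hQ
  have hf' : ∀ b, degreeOf i (Q.coeff b) ≤ D := hf
  have key : ∀ j b, pderiv j (Q.coeff b) + (b + 1) * Q.coeff (b + 1) * pderiv j g = 0 := by
    intro j b
    obtain ⟨P, h1, h2⟩ := aux_deriv (pderiv j) g Q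
    rw [aux_pderiv_zero (p := p) _ hfg] at h2
    have : P = 0 := by
      refine aux_zero i g _ P (Nat.lt_succ_self _) (fun b => ?_) h2
      rw [h1]
      refine lt_of_lt_of_le ?_ hgd
      refine lt_of_le_of_lt (degreeOf_add_le _ _ _) (max_lt ?_ ?_)
      · have := (aux_degree_pderiv i j (Q.coeff b)).trans (hf' b)
        omega
      · refine lt_of_le_of_lt (degreeOf_mul_le _ _ _) ?_
        have a1 : degreeOf i (((b : MvPolynomial (Fin n) k) + 1) * Q.coeff (b + 1)) ≤ D := by
          refine (degreeOf_mul_le _ _ _).trans ?_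
          have : ((b : MvPolynomial (Fin n) k) + 1) = C ((b : k) + 1) := by simp
          rw [this, degreeOf_C, zero_add]
          exact hf' _
        have a2 : degreeOf i (pderiv j g) ≤ e := by
          by_cases hj : j = i
          · rw [hj, hgi, hXe]
          · rw [hgj j hj]; simp
        omega
    rw [← h1, this, Polynomial.coeff_zero]
  have hb : ∀ b : ℕ, ((b : MvPolynomial (Fin n) k) + 1) * Q.coeff (b + 1) = 0 := by
    intro b
    by_contra hne
    have h := key i b
    rw [hgi] at h
    have h' : ((b : MvPolynomial (Fin n) k) + 1) * Q.coeff (b + 1) * X i ^ e = - pderiv i (Q.coeff b) := by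
      linear_combination h
    have h3 := congrArg (degreeOf i) h'
    rw [degreeOf_neg, degreeOf_mul_eq hne (pow_ne_zero _ (X_ne_zero i)), hXe] at h3
    have := (aux_degree_pderiv i i (Q.coeff b)).trans (hf' b)
    omega
  apply aux_f_mem
  · intro b
    apply aux_mem
    intro j
    have h := key j b
    rw [hb, zero_mul, add_zero] at h
    exact h
  · intro b
    cases b with
    | zero => simp
    | succ b => simpa using hb b

theorem aux_le {k : Type*} [Field k] {p : ℕ} [hp : Fact p.Prime] [CharP k p]
    {n : ℕ} (g : MvPolynomial (Fin n) k) : frobeniusSubmodule k p (n + 1) ≤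
          Submodule.comap (substLast g).toLinearMap (frobeniusSubmodule k p n) := by
  have : (Algebra.adjoin k (Set.range fun i : Fin (n + 1) =>
        (X i : MvPolynomial (Fin (n + 1)) k) ^ p)) ≤
        (Algebra.adjoin k (Set.range fun i : Fin n => (X i : MvPolynomial (Fin n) k) ^ p)).comap
        (substLast g) := by
    rw [Algebra.adjoin_le_iff]
    rintro _ ⟨i, rfl⟩
    simp only [Subalgebra.coe_comap, Set.mem_preimage]
    change _ ∈ frobeniusSubmodule k p n
    apply aux_mem
    intro j
    rw [map_pow, pderiv_pow, CharP.cast_eq_zero]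
    simp
  exact this

end helpers

/-- for finitely many finite-dimensional subspaces `V j` of
`k[x₁,…,x_n]/k[x₁^p,…,x_n^p]` (here the number of variables is `n + 1 ≥ 2`), there is a
polynomial `g` in the first `n` variables such that the substitution `x_i ↦ x_i`,
`x_{n+1} ↦ g` induces a map of quotients which is injective on each `V j`. -/
theorem statement0 {k : Type*} [Field k] {p : ℕ} [Fact p.Prime] [CharP k p] [PerfectField k]
    (n m : ℕ) (hn : 1 ≤ n)
    (V : Fin m → Submodule k (MvPolynomial (Fin (n + 1)) k ⧸ frobeniusSubmodule k p (n + 1)))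
    (hV : ∀ j, FiniteDimensional k (V j)) :
    ∃ g : MvPolynomial (Fin n) k,
      ∃ hle : frobeniusSubmodule k p (n + 1) ≤
          Submodule.comap (substLast g).toLinearMap (frobeniusSubmodule k p n),
        ∀ j, Set.InjOn
          (Submodule.mapQ (frobeniusSubmodule k p (n + 1)) (frobeniusSubmodule k p n)
            (substLast g).toLinearMap hle)
          (V j : Set (MvPolynomial (Fin (n + 1)) k ⧸ frobeniusSubmodule k p (n + 1))) := by
  have hW : (⨆ j, V j).FG := Submodule.fg_iSup _ fun j => Module.Finite.iff_fg.1 (hV j)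
  obtain ⟨S, hS⟩ := hW
  let i : Fin n := ⟨0, hn⟩
  have hsurj := Submodule.mkQ_surjective (frobeniusSubmodule k p (n + 1))
  choose L hL using hsurj
  choose E hE using fun f => auxB_exists (k := k) i f
  have hle : (⨆ j, V j) ≤ (auxB k i (S.sup fun s => E (L s))).map
      (frobeniusSubmodule k p (n + 1)).mkQ := by
    rw [← hS, Submodule.span_le]
    intro s hs
    exact ⟨L s, auxB_mono i (Finset.le_sup (f := fun s => E (L s)) hs) (hE _), hL s⟩
  obtain ⟨g, hg⟩ := aux_main (k := k) (p := p) i (S.sup fun s => E (L s))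
  refine ⟨g, aux_le g, fun j x hx y hy hxy => ?_⟩
  have hmem : x - y ∈ ⨆ j, V j := le_iSup V j (sub_mem hx hy)
  obtain ⟨f, hf, hfx⟩ := hle hmem
  have h0 : Submodule.mapQ (frobeniusSubmodule k p (n + 1)) (frobeniusSubmodule k p n)
            (substLast g).toLinearMap (aux_le g) (x - y) = 0 := by
    rw [map_sub, hxy, sub_self]
  rw [← hfx, Submodule.mkQ_apply, Submodule.mapQ_apply, Submodule.Quotient.mk_eq_zero] at h0
  have h1 := hg f hf h0
  rw [← sub_eq_zero, ← hfx, Submodule.mkQ_apply, Submodule.Quotient.mk_eq_zero]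
  exact h1
end

section
/- Let k be a perfect field of characteristic p > 0, let n ≥ 2 and d > 0 be integers, let M > d be an integer with p ∤ M, and let N > 0 be an integer with p^N > d(M+1). Set g := ∏_{i=1}^{n−1} (x_i^{p^N} + x_i^M) ∈ k[x₁,…,x_{n−1}]. Suppose (c_m) is a family of scalars in k indexed by the multi-indices m = (m₁,…,m_n) with 0 ≤ m_i ≤ d for all i and p ∤ m_i for at least one i, such that Σ_m c_m · x₁^{m₁} ⋯ x_{n−1}^{m_{n−1}} · g^{m_n} lies in k[x₁^p,…,x_{n−1}^p]. Then c_m = 0 for every such multi-index m. -/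
open MvPolynomial

lemma aux_uniq {d M q a j l a' j' l' : ℕ} (hM : d < M) (hq : d * (M + 1) < q)
    (ha : a ≤ d) (hl : l ≤ d) (ha' : a' ≤ d) (hl' : l' ≤ d)
    (h : a + q * j + M * l = a' + q * j' + M * l') : a = a' ∧ j = j' ∧ l = l' := by
  have b1 : a + M * l < q := by nlinarith [Nat.mul_le_mul_left M hl]
  have b2 : a' + M * l' < q := by nlinarith [Nat.mul_le_mul_left M hl']
  have e1 : (a + M * l) + q * j = (a' + M * l') + q * j' := by omega
  have hj : j = j' := by
    have := congrArg (· / q) e1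
    simpa [Nat.add_mul_div_left _ _ (by omega : 0 < q), Nat.div_eq_of_lt b1,
      Nat.div_eq_of_lt b2] using this
  subst hj
  have e2 : a + M * l = a' + M * l' := by omega
  have hll : l = l' := by
    have := congrArg (· / M) e2
    simpa [Nat.add_mul_div_left _ _ (by omega : 0 < M),
      Nat.div_eq_of_lt (by omega : a < M), Nat.div_eq_of_lt (by omega : a' < M)] using this
  subst hll
  exact ⟨by omega, rfl, rfl⟩

lemma aux_coeff {k : Type*} [Field k] (a e q M s : ℕ) :
    ((Polynomial.X ^ a * (Polynomial.X ^ q + Polynomial.X ^ M) ^ e : Polynomial k)).coeff s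
      = ∑ j ∈ Finset.range (e + 1), if s = a + q * j + M * (e - j) then (e.choose j : k) else 0 := by
  rw [add_pow, Finset.mul_sum, Polynomial.finsetSum_coeff]
  refine Finset.sum_congr rfl fun j _ => ?_
  have : (Polynomial.X ^ a * ((Polynomial.X ^ q) ^ j * (Polynomial.X ^ M) ^ (e - j)
      * ((e.choose j : ℕ) : Polynomial k)) : Polynomial k)
      = Polynomial.C (e.choose j : k) * Polynomial.X ^ (a + q * j + M * (e - j)) := by
    rw [map_natCast]; ring
  rw [this, Polynomial.coeff_C_mul_X_pow]

lemma aux_ne {k : Type*} [Field k] {a e q M s : ℕ}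
    (h : ((Polynomial.X ^ a * (Polynomial.X ^ q + Polynomial.X ^ M) ^ e : Polynomial k)).coeff s ≠ 0) :
    ∃ j l, j + l = e ∧ s = a + q * j + M * l := by
  rw [aux_coeff] at h
  obtain ⟨j, hj, hne⟩ := Finset.exists_ne_zero_of_sum_ne_zero h
  rw [Finset.mem_range] at hj
  refine ⟨j, e - j, by omega, ?_⟩
  by_contra hs
  exact hne (if_neg hs)

lemma aux_val {k : Type*} [Field k] {d M q a j l : ℕ} (hM : d < M) (hq : d * (M + 1) < q)
    (ha : a ≤ d) (he : j + l ≤ d) :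
    ((Polynomial.X ^ a * (Polynomial.X ^ q + Polynomial.X ^ M) ^ (j + l) : Polynomial k)).coeff
      (a + q * j + M * l) = ((j + l).choose j : k) := by
  rw [aux_coeff, Finset.sum_eq_single j]
  · simp
  · intro j' hj' hne
    rw [Finset.mem_range] at hj'
    refine if_neg fun h => hne ?_
    exact (aux_uniq hM hq ha (by omega) ha (by omega) h).2.1.symm
  · intro h
    simp at h

lemma aux_prod {k : Type*} [Field k] {n : ℕ} (f : Fin n → Polynomial k) (s : Fin n →₀ ℕ) :
    (∏ i, Polynomial.aeval (X i : MvPolynomial (Fin n) k) (f i)).coeff s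
      = ∏ i, (f i).coeff (s i) := by
  classical
  have h1 : ∀ i, Polynomial.aeval (X i : MvPolynomial (Fin n) k) (f i)
      = ∑ j ∈ (f i).support, monomial (Finsupp.single i j) ((f i).coeff j) := by
    intro i
    rw [Polynomial.aeval_def, Polynomial.eval₂_eq_sum, Polynomial.sum]
    refine Finset.sum_congr rfl fun j _ => ?_
    rw [X_pow_eq_monomial, algebraMap_eq, C_mul_monomial, mul_one]
  simp_rw [h1]
  rw [Finset.prod_univ_sum, coeff_sum]
  have h2 : ∀ φ : Fin n → ℕ, (∏ i, monomial (Finsupp.single i (φ i)) ((f i).coeff (φ i)) :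
      MvPolynomial (Fin n) k) = monomial (Finsupp.equivFunOnFinite.symm φ) (∏ i, (f i).coeff (φ i)) := by
    intro φ
    rw [← monomial_sum_prod]
    congr 2
    ext i
    simp [Finsupp.finsetSum_apply, Finsupp.single_apply]
  simp_rw [h2, coeff_monomial]
  by_cases hs : ∀ i, s i ∈ (f i).support
  · rw [Finset.sum_eq_single (s : Fin n → ℕ)]
    · rw [if_pos (by ext; simp)]
    · intro φ _ hne
      refine if_neg fun h => hne ?_
      rw [← h]; ext; simp
    · intro h
      exact absurd (Fintype.mem_piFinset.2 hs) h
  · rw [Finset.sum_eq_zero]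
    · push Not at hs
      obtain ⟨i, hi⟩ := hs
      exact (Finset.prod_eq_zero (Finset.mem_univ i) (by simpa using hi)).symm
    · intro φ hφ
      refine if_neg fun h => hs fun i => ?_
      rw [← h]
      simpa using (Fintype.mem_piFinset.1 hφ i)

lemma aux_frob {k : Type*} [Field k] {p n : ℕ} {F : MvPolynomial (Fin n) k}
    (hF : F ∈ frobeniusSubmodule k p n) (s : Fin n →₀ ℕ) (i : Fin n) (hi : ¬ p ∣ s i) :
    F.coeff s = 0 := by
  have hle : Algebra.adjoin k (Set.range fun i : Fin n => (X i : MvPolynomial (Fin n) k) ^ p)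
      ≤ (expand p : MvPolynomial (Fin n) k →ₐ[k] _).range := by
    rw [Algebra.adjoin_le_iff]
    rintro _ ⟨i, rfl⟩
    exact ⟨X i, by simp⟩
  obtain ⟨G, rfl⟩ := hle (show F ∈ Algebra.adjoin k _ from hF)
  exact coeff_expand_of_not_dvd G hi

/-- with `g = ∏_{i=1}^{n} (x_i^{p^N} + x_i^M)` (here the number of original
variables is `n + 1 ≥ 2`, so the target ring has `n` variables), if a `k`-linear combination
`Σ c_m x₁^{m₁} ⋯ x_n^{m_n} g^{m_{n+1}}` over multi-indices `m` with all `m_i ≤ d` and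
`p ∤ m_i` for some `i` lies in `k[x₁^p, …, x_n^p]`, then all coefficients vanish. -/
theorem statement1 {k : Type*} [Field k] {p : ℕ} [Fact p.Prime] [CharP k p] [PerfectField k]
    (n d M N : ℕ) (hn : 1 ≤ n) (hd : 0 < d) (hM : d < M) (hpM : ¬ p ∣ M)
    (hN : 0 < N) (hpN : d * (M + 1) < p ^ N)
    (c : (Fin (n + 1) → Fin (d + 1)) → k)
    (hc : ∀ m : Fin (n + 1) → Fin (d + 1), (∀ i, p ∣ (m i : ℕ)) → c m = 0)
    (hmem : (∑ m : Fin (n + 1) → Fin (d + 1),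
        c m • ((∏ i : Fin n, (X i : MvPolynomial (Fin n) k) ^ (m i.castSucc : ℕ)) *
          (∏ i : Fin n, ((X i : MvPolynomial (Fin n) k) ^ (p ^ N) + (X i) ^ M))
            ^ (m (Fin.last n) : ℕ)))
        ∈ frobeniusSubmodule k p n) :
    ∀ m : Fin (n + 1) → Fin (d + 1), c m = 0 := by
  classical
  set q := p ^ N with hqdef
  have hpq : p ∣ q := dvd_pow_self p (by omega)
  have key : ∀ (m : Fin (n + 1) → Fin (d + 1)) (j l : Fin n → ℕ),
      (∀ i, j i + l i = (m (Fin.last n) : ℕ)) →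
      (∃ i : Fin n, ¬ p ∣ (m i.castSucc : ℕ) + q * j i + M * l i) →
      (∀ i, ((((m (Fin.last n) : ℕ).choose (j i) : ℕ)) : k) ≠ 0) → c m = 0 := by
    intro m j l hjl ⟨i0, hi0⟩ hne
    let s : Fin n →₀ ℕ := Finsupp.equivFunOnFinite.symm
      fun i => (m i.castSucc : ℕ) + q * j i + M * l i
    have hs : ∀ i, s i = (m i.castSucc : ℕ) + q * j i + M * l i := fun i => by simp [s]
    have h0 := aux_frob hmem s i0 (by rw [hs]; exact hi0)
    rw [coeff_sum] at h0
    have hterm : ∀ m' : Fin (n + 1) → Fin (d + 1),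
        (c m' • ((∏ i : Fin n, (X i : MvPolynomial (Fin n) k) ^ (m' i.castSucc : ℕ)) *
          (∏ i : Fin n, ((X i : MvPolynomial (Fin n) k) ^ q + (X i) ^ M))
            ^ (m' (Fin.last n) : ℕ))).coeff s = c m' * ∏ i : Fin n,
        ((Polynomial.X ^ (m' i.castSucc : ℕ) * (Polynomial.X ^ q + Polynomial.X ^ M) ^
          (m' (Fin.last n) : ℕ) : Polynomial k)).coeff (s i) := by
      intro m'
      rw [coeff_smul, smul_eq_mul, ← aux_prod, ← Finset.prod_pow, ← Finset.prod_mul_distrib]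
      simp
    simp_rw [hterm] at h0
    rw [Finset.sum_eq_single m] at h0
    · refine (mul_eq_zero.1 h0).resolve_right (Finset.prod_ne_zero_iff.2 fun i _ => ?_)
      have := hne i
      rw [hs, ← hjl i, aux_val hM hpN (by omega) (by have := hjl i; omega)]
      rwa [hjl i]
    · intro m' _ hmm
      by_contra hcon
      have h2 := Finset.prod_ne_zero_iff.1 (right_ne_zero_of_mul hcon)
      have h3 : ∀ i : Fin n, (m' i.castSucc : ℕ) = m i.castSucc ∧
          (m' (Fin.last n) : ℕ) = m (Fin.last n) := by
        intro i
        obtain ⟨j', l', hjl', he⟩ := aux_ne (h2 i (Finset.mem_univ i))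
        rw [hs] at he
        have h1 := hjl i
        have := aux_uniq hM hpN (by omega) (by omega) (by omega) (by omega) he
        omega
      apply hmm
      funext i
      refine Fin.lastCases ?_ (fun i => ?_) i
      · exact Fin.ext (h3 ⟨0, hn⟩).2
      · exact Fin.ext (h3 i).1
    · simp
  intro m
  by_cases h1 : ∀ i : Fin n, p ∣ (m i.castSucc : ℕ)
  · by_cases h2 : p ∣ (m (Fin.last n) : ℕ)
    · exact hc m fun i => Fin.lastCases h2 h1 i
    · have hpos : 0 < (m (Fin.last n) : ℕ) := Nat.pos_of_ne_zero fun h => h2 (by simp [h])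
      refine key m (fun i => if i = ⟨0, hn⟩ then (m (Fin.last n) : ℕ) - 1 else m (Fin.last n))
        (fun i => if i = ⟨0, hn⟩ then 1 else 0) ?_ ⟨⟨0, hn⟩, ?_⟩ ?_
      · intro i
        split_ifs <;> omega
      · simp only [if_true, mul_one]
        rw [Nat.dvd_add_right (dvd_add (h1 _) (hpq.mul_right _))]
        exact hpM
      · intro i
        split_ifs
        · rw [Nat.choose_symm (by omega : 1 ≤ (m (Fin.last n) : ℕ)), Nat.choose_one_right]
          rwa [Ne, CharP.cast_eq_zero_iff k p]
        · simp
  · push Not at h1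
    obtain ⟨i, hi⟩ := h1
    refine key m (fun _ => m (Fin.last n)) (fun _ => 0) (by simp) ⟨i, ?_⟩ (by simp)
    rw [mul_zero, add_zero, Nat.dvd_add_left (hpq.mul_right _)]
    exact hi
end

section
/- Let k be a perfect field of characteristic p > 0, let n ≥ 2, d > 0, M > d with p ∤ M, and N > 0 with p^N > d(M+1) be integers. Then the following elements of the quotient k-vector space k[x₁,…,x_{n−1}]/k[x₁^p,…,x_{n−1}^p] are pairwise distinct and linearly independent over k: (a) the classes of x₁^{m₁}⋯x_{n−1}^{m_{n−1}} for all (m₁,…,m_{n−1}) with 0 ≤ m_i ≤ d and p ∤ m_i for some i; (b) the classes of ∏_{i=1}^{n−1} x_i^{m_i + m_n M} for all (m₁,…,m_n) with 0 ≤ m_i ≤ d for all i, p | m_i for every 1 ≤ i ≤ n−1, and p ∤ m_n; (c) the classes of ∏_{i=1}^{n−1} x_i^{m_i + m_n p^N} for all (m₁,…,m_n) with 0 ≤ m_i ≤ d for all i, m_n ≠ 0, and p ∤ m_i for some 1 ≤ i ≤ n−1. -/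
open MvPolynomial

theorem frob_coeff {k : Type*} [CommRing k] {p n : ℕ} {f : MvPolynomial (Fin n) k}
    (hf : f ∈ frobeniusSubmodule k p n) (s : Fin n →₀ ℕ) (hs : ∃ i, ¬ p ∣ s i) :
    coeff s f = 0 := by
  classical
  have key : ∀ s : Fin n →₀ ℕ, coeff s f ≠ 0 → ∀ i, p ∣ s i := by
    clear hs s
    have hf' : f ∈ Algebra.adjoin k
      (Set.range fun i : Fin n => (X i : MvPolynomial (Fin n) k) ^ p) := hf
    clear hf
    induction hf' using Algebra.adjoin_induction with
    | mem x hx =>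
      obtain ⟨j, rfl⟩ := hx
      intro s hs i
      simp only [coeff_X_pow] at hs
      have h : Finsupp.single j p = s := by
        by_contra h
        simp [h] at hs
      rw [← h, Finsupp.single_apply]
      split_ifs <;> simp
    | algebraMap r =>
      intro s hs i
      rw [algebraMap_eq, coeff_C] at hs
      have h : 0 = s := by
        by_contra h
        simp [h] at hs
      simp [← h]
    | add x y _ _ hx hy =>
      intro s hs i
      by_cases h : coeff s x = 0
      · exact hy s (by simpa [h] using hs) i
      · exact hx s h i
    | mul x y _ _ hx hy =>
      intro s hs i
      rw [coeff_mul] at hs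
      obtain ⟨a, ha, hne⟩ := Finset.exists_ne_zero_of_sum_ne_zero hs
      rw [Finset.HasAntidiagonal.mem_antidiagonal] at ha
      rw [← ha, Finsupp.add_apply]
      exact dvd_add (hx _ (left_ne_zero_of_mul hne) i) (hy _ (right_ne_zero_of_mul hne) i)
  by_contra h
  obtain ⟨i, hi⟩ := hs
  exact hi (key s h i)

theorem frob_indep {k : Type*} [Field k] {p n : ℕ} {ι : Type*} (e : ι → Fin n → ℕ)
    (he : Function.Injective e) (hp : ∀ j, ∃ i, ¬ p ∣ e j i) :
    LinearIndependent k (fun j => Submodule.Quotient.mk (p := frobeniusSubmodule k p n)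
      (∏ i : Fin n, (X i : MvPolynomial (Fin n) k) ^ (e j i))) := by
  classical
  rw [linearIndependent_iff']
  intro t g hg j hj
  have hmono : ∀ j, (∏ i : Fin n, (X i : MvPolynomial (Fin n) k) ^ (e j i))
      = monomial (Finsupp.equivFunOnFinite.symm (e j)) 1 := by
    intro j
    rw [monomial_eq, Finsupp.prod_fintype _ _ (by simp)]
    simp
  have hmem : ∑ j ∈ t, g j • (∏ i : Fin n, (X i : MvPolynomial (Fin n) k) ^ (e j i))
      ∈ frobeniusSubmodule k p n := by
    rw [← Submodule.ker_mkQ (frobeniusSubmodule k p n), LinearMap.mem_ker, map_sum, ← hg]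
    refine Finset.sum_congr rfl fun j _ => ?_
    rw [map_smul]
    rfl
  have h := frob_coeff hmem (Finsupp.equivFunOnFinite.symm (e j)) (hp j)
  simp only [hmono, coeff_sum, coeff_smul, coeff_monomial, EmbeddingLike.apply_eq_iff_eq,
    he.eq_iff] at h
  simpa [hj] using h

theorem arith_aux {a b a' b' K : ℕ} (h : a + b * K = a' + b' * K) (ha : a < K) (ha' : a' < K) :
    a = a' ∧ b = b' := by
  have hK : 0 < K := by omega
  have h1 : a = a' := by
    have := congrArg (· % K) h
    simpa [Nat.mod_eq_of_lt ha, Nat.mod_eq_of_lt ha'] using this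
  subst h1
  exact ⟨rfl, Nat.eq_of_mul_eq_mul_right hK (by omega)⟩

/-- the classes in `k[x₁,…,x_n]/k[x₁^p,…,x_n^p]` (here the number of variables
of the target ring is `n ≥ 1`, corresponding to `n - 1` in the paper) of
(a) `x₁^{m₁} ⋯ x_n^{m_n}` for multi-indices `m` of length `n` with `m_i ≤ d` and `p ∤ m_i`
for some `i`;
(b) `∏ x_i^{m_i + m_{n+1} M}` for multi-indices `m` of length `n + 1` with `m_i ≤ d`,
`p ∣ m_i` for every `i ≤ n`, and `p ∤ m_{n+1}`;
(c) `∏ x_i^{m_i + m_{n+1} p^N}` for multi-indices `m` of length `n + 1` with `m_i ≤ d`,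
`m_{n+1} ≠ 0`, and `p ∤ m_i` for some `i ≤ n`;
form (as a family indexed by the disjoint union of these index sets) a linearly independent
family over `k`; in particular they are pairwise distinct. -/
theorem statement2 {k : Type*} [Field k] {p : ℕ} [Fact p.Prime] [CharP k p] [PerfectField k]
    (n d M N : ℕ) (hn : 1 ≤ n) (hd : 0 < d) (hM : d < M) (hpM : ¬ p ∣ M)
    (hN : 0 < N) (hpN : d * (M + 1) < p ^ N) :
    LinearIndependent k
      (Sum.elim
        (fun m : {m : Fin n → Fin (d + 1) // ∃ i, ¬ p ∣ (m i : ℕ)} =>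
          Submodule.Quotient.mk (p := frobeniusSubmodule k p n)
            (∏ i : Fin n, (X i : MvPolynomial (Fin n) k) ^ (m.1 i : ℕ)))
        (Sum.elim
          (fun m : {m : Fin (n + 1) → Fin (d + 1) //
              (∀ i : Fin n, p ∣ (m i.castSucc : ℕ)) ∧ ¬ p ∣ (m (Fin.last n) : ℕ)} =>
            Submodule.Quotient.mk (p := frobeniusSubmodule k p n)
              (∏ i : Fin n, (X i : MvPolynomial (Fin n) k)
                ^ ((m.1 i.castSucc : ℕ) + (m.1 (Fin.last n) : ℕ) * M)))
          (fun m : {m : Fin (n + 1) → Fin (d + 1) //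
              (m (Fin.last n) : ℕ) ≠ 0 ∧ ∃ i : Fin n, ¬ p ∣ (m i.castSucc : ℕ)} =>
            Submodule.Quotient.mk (p := frobeniusSubmodule k p n)
              (∏ i : Fin n, (X i : MvPolynomial (Fin n) k)
                ^ ((m.1 i.castSucc : ℕ) + (m.1 (Fin.last n) : ℕ) * p ^ N))))) := by
  have hp : p.Prime := Fact.out
  have hle : ∀ x : Fin (d + 1), (x : ℕ) ≤ d := fun x => Nat.lt_succ_iff.mp x.2
  have hdp : d < p ^ N := by nlinarith
  let i0 : Fin n := ⟨0, hn⟩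
  have key := frob_indep (k := k) (p := p) (n := n)
    (Sum.elim
      (fun (m : {m : Fin n → Fin (d + 1) // ∃ i, ¬ p ∣ (m i : ℕ)}) (i : Fin n) => (m.1 i : ℕ))
      (Sum.elim
        (fun (m : {m : Fin (n + 1) → Fin (d + 1) //
              (∀ i : Fin n, p ∣ (m i.castSucc : ℕ)) ∧ ¬ p ∣ (m (Fin.last n) : ℕ)}) (i : Fin n) =>
            ((m.1 i.castSucc : ℕ) + (m.1 (Fin.last n) : ℕ) * M))
        (fun (m : {m : Fin (n + 1) → Fin (d + 1) //
              (m (Fin.last n) : ℕ) ≠ 0 ∧ ∃ i : Fin n, ¬ p ∣ (m i.castSucc : ℕ)}) (i : Fin n) =>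
            ((m.1 i.castSucc : ℕ) + (m.1 (Fin.last n) : ℕ) * p ^ N)))) ?_ ?_
  · convert key using 1
    funext j
    rcases j with j | j | j <;> rfl
  · refine Function.Injective.sumElim ?_ (Function.Injective.sumElim ?_ ?_ ?_) ?_
    · intro a b h
      apply Subtype.ext
      funext i
      exact Fin.ext (congrFun h i)
    · intro a b h
      have h' := fun i => arith_aux (congrFun h i) ((hle _).trans_lt hM) ((hle _).trans_lt hM)
      apply Subtype.ext
      funext i
      induction i using Fin.lastCases with
      | last => exact Fin.ext (h' i0).2
      | cast i => exact Fin.ext (h' i).1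
    · intro a b h
      have h' := fun i => arith_aux (congrFun h i) ((hle _).trans_lt hdp) ((hle _).trans_lt hdp)
      apply Subtype.ext
      funext i
      induction i using Fin.lastCases with
      | last => exact Fin.ext (h' i0).2
      | cast i => exact Fin.ext (h' i).1
    · intro a b h
      have h0 := congrFun h i0
      have h1 := hle (a.1 i0.castSucc)
      have h2 := Nat.mul_le_mul_right M (hle (a.1 (Fin.last n)))
      have h3 := Nat.mul_le_mul_right (p ^ N) (Nat.one_le_iff_ne_zero.mpr b.2.1)
      have h4 : d * (M + 1) = d * M + d := by ring
      omega
    · rintro a (b | b) h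
      · have h0 := congrFun h i0
        simp only [Sum.elim_inl] at h0
        have h1 := hle (a.1 i0)
        have hb : (b.1 (Fin.last n) : ℕ) ≠ 0 := fun h => b.2.2 (by simp [h])
        have h3 := Nat.mul_le_mul_right M (Nat.one_le_iff_ne_zero.mpr hb)
        omega
      · have h0 := congrFun h i0
        simp only [Sum.elim_inr] at h0
        have h1 := hle (a.1 i0)
        have h3 := Nat.mul_le_mul_right (p ^ N) (Nat.one_le_iff_ne_zero.mpr b.2.1)
        omega
  · rintro (m | m | m)
    · exact m.2
    · refine ⟨i0, fun h => ?_⟩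
      have h' := (Nat.dvd_add_right (m.2.1 i0)).mp h
      rcases hp.dvd_mul.mp h' with h | h
      · exact m.2.2 h
      · exact hpM h
    · obtain ⟨i, hi⟩ := m.2.2
      refine ⟨i, fun h => hi ?_⟩
      exact (Nat.dvd_add_left (Dvd.dvd.mul_left (dvd_pow_self p hN.ne') _)).mp h
end

section
/- Let k be a perfect field of characteristic 2 and let f₁₁, f₁₂, f₂₁, f₂₂ ∈ k[x] satisfy f₁₁f₂₂ − f₁₂f₂₁ = 1. Assume that the images of f₁₁f₂₁ and f₁₂f₂₂ in k[x]/k[x²] are linearly independent over k, and that either the images of f₁₁ and f₂₁ in k[x]/k[x²] are linearly independent over k, or the images of f₁₂ and f₂₂ in k[x]/k[x²] are linearly independent over k. Then the images of f₁₁f₁₂ and f₂₁f₂₂ in k[x]/k[x²] are linearly independent over k. -/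
open Polynomial

/-- The `k`-subspace `k[x²]` of `k[x]`, i.e. the subalgebra of all polynomials in `x²`,
viewed as a `k`-submodule. -/
noncomputable def squaresSubmodule (k : Type*) [CommRing k] : Submodule k (Polynomial k) :=
  Subalgebra.toSubmodule (Algebra.adjoin k {(X : Polynomial k) ^ 2})

/-- The image of a polynomial in the quotient `k`-vector space `k[x]/k[x²]`. -/
noncomputable def sqClass {k : Type*} [CommRing k] (f : Polynomial k) :
    Polynomial k ⧸ squaresSubmodule k :=
  Submodule.Quotient.mk f

theorem sqClass_eq_zero_iff' {k : Type*} [Field k] [CharP k 2] (f : Polynomial k) :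
    sqClass f = 0 ↔ derivative f = 0 := by
  unfold sqClass squaresSubmodule
  rw [Submodule.Quotient.mk_eq_zero, Subalgebra.mem_toSubmodule]
  constructor
  · intro h
    induction h using Algebra.adjoin_induction with
    | mem x hx =>
      rw [Set.mem_singleton_iff] at hx
      subst hx
      have h2 : (C 2 : k[X]) = 0 := by rw [CharTwo.two_eq_zero, C_0]
      rw [derivative_X_sq, h2, zero_mul]
    | algebraMap r => simp [Polynomial.algebraMap_eq]
    | add x y _ _ hx hy => simp [hx, hy]
    | mul x y _ _ hx hy => simp [hx, hy]
  · intro h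
    have := Polynomial.expand_contract 2 h (by norm_num)
    rw [← this, Polynomial.expand_eq_comp_X_pow, Algebra.adjoin_singleton_eq_range_aeval]
    exact ⟨contract 2 f, by simp [aeval_def, comp, Polynomial.algebraMap_eq]⟩

theorem deriv_zero_of_coprime {k : Type*} [Field k] (u v : Polynomial k)
    (h : IsCoprime u v) (hd : derivative (u * v) = 0) : derivative u = 0 := by
  rw [derivative_mul] at hd
  have h1 : u ∣ derivative u * v := ⟨- derivative v, by linear_combination hd⟩
  have h2 := h.dvd_of_dvd_mul_right h1
  by_contra hne
  have hu : u ≠ 0 := by rintro rfl; simp at hne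
  exact absurd (degree_le_of_dvd h2 hne) (not_le.2 (degree_derivative_lt hu))

theorem dep_aux {k : Type*} [Field k] [CharP k 2] (f g : Polynomial k) (a b : k) :
    a • sqClass f + b • sqClass g = 0 ↔ derivative (C a * f + C b * g) = 0 := by
  rw [← sqClass_eq_zero_iff', ← smul_eq_C_mul, ← smul_eq_C_mul]
  rfl

/-- over a perfect field of characteristic 2, if `f₁₁f₂₂ - f₁₂f₂₁ = 1`, the
images of `f₁₁f₂₁` and `f₁₂f₂₂` in `k[x]/k[x²]` are linearly independent, and the images of
`f₁₁, f₂₁` or of `f₁₂, f₂₂` are linearly independent, then the images of `f₁₁f₁₂` and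
`f₂₁f₂₂` are linearly independent. -/
theorem statement4 {k : Type*} [Field k] [CharP k 2] [PerfectField k]
    (f11 f12 f21 f22 : Polynomial k)
    (hdet : f11 * f22 - f12 * f21 = 1)
    (h1 : LinearIndependent k ![sqClass (f11 * f21), sqClass (f12 * f22)])
    (h2 : LinearIndependent k ![sqClass f11, sqClass f21] ∨
          LinearIndependent k ![sqClass f12, sqClass f22]) :
    LinearIndependent k ![sqClass (f11 * f12), sqClass (f21 * f22)] := by
  rw [LinearIndependent.pair_iff]
  intro a b hab
  rw [dep_aux] at hab
  have : CharP k[X] 2 := inferInstance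
  have htwo : (2 : k[X]) = 0 := CharTwo.two_eq_zero
  have : ExpChar k 2 := ExpChar.prime Nat.prime_two
  have : PerfectRing k 2 := PerfectField.toPerfectRing 2
  obtain ⟨α, rfl⟩ := surjective_frobenius k 2 a
  obtain ⟨β, rfl⟩ := surjective_frobenius k 2 b
  simp only [frobenius_def, C_pow] at hab ⊢
  by_contra hne
  have hne' : α ≠ 0 ∨ β ≠ 0 := by
    by_contra hh
    push Not at hh
    exact hne (by simp [hh.1, hh.2])
  set v := C α * f11 + C β * f21 with hv
  set u := C α * f12 + C β * f22 with hu
  have huv : u * v = (C α ^ 2 * (f11 * f12) + C β ^ 2 * (f21 * f22)) + C (α * β) := by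
    rw [C_mul]
    linear_combination C α * C β * hdet + C α * C β * f12 * f21 * htwo
  have hd : derivative (u * v) = 0 := by
    rw [huv, derivative_add, hab, derivative_C, add_zero]
  have hcop : IsCoprime u v := by
    rcases hne' with h | h
    · have hc : C α⁻¹ * C α = (1 : k[X]) := by rw [← C_mul, inv_mul_cancel₀ h, C_1]
      exact ⟨-(C α⁻¹ * f21), C α⁻¹ * f22, by
        linear_combination C α⁻¹ * C α * hdet + hc⟩
    · have hc : C β⁻¹ * C β = (1 : k[X]) := by rw [← C_mul, inv_mul_cancel₀ h, C_1]
      exact ⟨C β⁻¹ * f11, -(C β⁻¹ * f12), by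
        linear_combination C β⁻¹ * C β * hdet + hc⟩
  have hu0 := deriv_zero_of_coprime u v hcop hd
  have hv0 := deriv_zero_of_coprime v u hcop.symm (by rw [mul_comm]; exact hd)
  rw [hu, ← dep_aux] at hu0
  rw [hv, ← dep_aux] at hv0
  rw [LinearIndependent.pair_iff, LinearIndependent.pair_iff] at h2
  have : α = 0 ∧ β = 0 := by
    rcases h2 with h | h
    · exact h _ _ hv0
    · exact h _ _ hu0
  tauto
end

section
/- Let k be an algebraically closed field of characteristic 2 and let f₁₁, f₁₂, f₂₁, f₂₂ ∈ k[x] satisfy f₁₁f₂₂ + f₁₂f₂₁ = 1. Assume that the images of f₁₁f₂₁ and f₁₂f₂₂ in k[x]/k[x²] are linearly independent over k, and that either the images of f₁₁, f₂₁ or the images of f₁₂, f₂₂ in k[x]/k[x²] are linearly independent over k. Let g_{ij} ∈ k[t] be the unique polynomials with g_{ij}(t)² = f_{ij}(t²). Define 2×2 matrices over k[t]: B := [[g₁₁, g₂₁],[g₁₂, g₂₂]], E := the identity, D := [[0, g₁₂g₂₂],[g₁₁g₂₁, 0]], and for c ∈ k[t,t⁻¹] the 4×4 matrix C(c) := [[1,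 g₁₁g₂₁, g₁₂g₂₂, c],[0, 1, 0, g₁₂g₂₂],[0, 0, 1, g₁₁g₂₁],[0, 0, 0, 1]]. Let A(c) be the 16×16 block matrix over k[t,t⁻¹] whose diagonal 4×4 blocks are C(c), B⊗E, B⊗B, B⊗E in this order, whose block in block-row 2 and block-column 4 is B⊗D, and whose remaining off-diagonal blocks are zero. Then for every c ∈ k[t,t⁻¹], the k-vector space { a ∈ k¹⁶ : every entry of A(c)·a lies in the subalgebra k[t², t⁻²] of k[t, t⁻¹] } has dimension exactly 2. -/
open Polynomial LaurentPolynomial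

/-- The `k`-subspace `k[t², t⁻²]` of the Laurent polynomial ring `k[t, t⁻¹]`, i.e. the
subalgebra generated by `t²` and `t⁻²`, viewed as a `k`-submodule. -/
noncomputable def evenLaurentSubmodule (k : Type*) [CommRing k] :
    Submodule k (LaurentPolynomial k) :=
  Subalgebra.toSubmodule
    (Algebra.adjoin k ({T 2, T (-2)} : Set (LaurentPolynomial k)))

/-- The Kronecker product of two 2×2 matrices, as a 4×4 matrix:
`B ⊗ M = [[B₁₁M, B₁₂M], [B₂₁M, B₂₂M]]`. -/
def kron2 {R : Type*} [Mul R] (B M : Matrix (Fin 2) (Fin 2) R) :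
    Matrix (Fin 4) (Fin 4) R :=
  Matrix.of fun i j =>
    B ⟨(i : ℕ) / 2, by omega⟩ ⟨(j : ℕ) / 2, by omega⟩ *
      M ⟨(i : ℕ) % 2, by omega⟩ ⟨(j : ℕ) % 2, by omega⟩

/-- The 16×16 block matrix `A(c)` of the even-determinant case: diagonal blocks
`C(c), B⊗E, B⊗B, B⊗E`, the block in block-row 2 and block-column 4 equal to `B⊗D`, and all
other off-diagonal blocks zero, where `B = [[g₁₁, g₂₁],[g₁₂, g₂₂]]`,
`D = [[0, g₁₂g₂₂],[g₁₁g₂₁, 0]]` and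
`C(c) = [[1, g₁₁g₂₁, g₁₂g₂₂, c],[0,1,0,g₁₂g₂₂],[0,0,1,g₁₁g₂₁],[0,0,0,1]]`. -/
noncomputable def bigMatrixEven {k : Type*} [CommRing k]
    (g11 g12 g21 g22 : Polynomial k) (c : LaurentPolynomial k) :
    Matrix (Fin 16) (Fin 16) (LaurentPolynomial k) :=
  let ι : Polynomial k →+* LaurentPolynomial k := Polynomial.toLaurent
  let B : Matrix (Fin 2) (Fin 2) (LaurentPolynomial k) :=
    !![ι g11, ι g21; ι g12, ι g22]
  let D : Matrix (Fin 2) (Fin 2) (LaurentPolynomial k) :=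
    !![0, ι g12 * ι g22; ι g11 * ι g21, 0]
  let Cc : Matrix (Fin 4) (Fin 4) (LaurentPolynomial k) :=
    !![1, ι g11 * ι g21, ι g12 * ι g22, c;
       0, 1, 0, ι g12 * ι g22;
       0, 0, 1, ι g11 * ι g21;
       0, 0, 0, 1]
  Matrix.of fun i j =>
    let ii : Fin 4 := ⟨(i : ℕ) % 4, by omega⟩
    let jj : Fin 4 := ⟨(j : ℕ) % 4, by omega⟩
    if (i : ℕ) / 4 = 0 ∧ (j : ℕ) / 4 = 0 then Cc ii jj
    else if (i : ℕ) / 4 = 1 ∧ (j : ℕ) / 4 = 1 then kron2 B 1 ii jj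
    else if (i : ℕ) / 4 = 2 ∧ (j : ℕ) / 4 = 2 then kron2 B B ii jj
    else if (i : ℕ) / 4 = 3 ∧ (j : ℕ) / 4 = 3 then kron2 B 1 ii jj
    else if (i : ℕ) / 4 = 1 ∧ (j : ℕ) / 4 = 3 then kron2 B D ii jj
    else 0

lemma even_coeff {k : Type*} [CommRing k] {x : LaurentPolynomial k}
    (hx : x ∈ evenLaurentSubmodule k) (n : ℤ) (hn : ¬ Even n) : x.coeff n = 0 := by
  let φ : LaurentPolynomial k →ₐ[k] LaurentPolynomial k :=
    AddMonoidAlgebra.mapDomainAlgHom k k (AddMonoidHom.mulLeft (2 : ℤ))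
  have hle : Algebra.adjoin k ({T 2, T (-2)} : Set (LaurentPolynomial k)) ≤ φ.range := by
    rw [Algebra.adjoin_le_iff]
    rintro y (rfl | rfl)
    · exact ⟨T 1, AddMonoidAlgebra.mapDomain_single⟩
    · exact ⟨T (-1), (AddMonoidAlgebra.mapDomain_single (f := AddMonoidHom.mulLeft (2:ℤ)) (a := (-1:ℤ)) (r := (1:k)) :)⟩
  obtain ⟨y, rfl⟩ := hle hx
  apply Finsupp.mapDomain_of_notMem_range
  rintro ⟨m, rfl⟩
  exact hn (by simp)

lemma deriv_zero_of_even {k : Type*} [Field k] [CharP k 2] {p : Polynomial k}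
    (hx : toLaurent p ∈ evenLaurentSubmodule k) : derivative p = 0 := by
  ext n
  rw [coeff_derivative, coeff_zero]
  rcases Nat.even_or_odd (n+1) with h | h
  · have : ((n + 1 : ℕ) : k) = 0 := by
      rw [CharP.cast_eq_zero_iff k 2]; exact h.two_dvd
    push_cast at this
    rw [this, mul_zero]
  · have := even_coeff hx ((n+1 : ℕ) : ℤ) (by rw [Int.even_coe_nat]; exact Nat.not_even_iff_odd.2 h)
    have e : (toLaurent p).coeff ((n+1 : ℕ) : ℤ) = p.coeff (n+1) := by
      rw [coeff_toLaurent]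
      exact Finsupp.mapDomain_apply Nat.castEmbedding.injective _ _
    rw [← e, this, zero_mul]

lemma indep {k : Type*} [Field k] [CharP k 2] {F G p q : Polynomial k}
    (h : LinearIndependent k ![sqClass F, sqClass G])
    (hp : p ^ 2 = expand k 2 F) (hq : q ^ 2 = expand k 2 G) (α β : k)
    (hd : derivative (Polynomial.C α * p + Polynomial.C β * q) = 0) : α = 0 ∧ β = 0 := by
  have : ExpChar k 2 := ExpChar.prime Nat.prime_two
  have hr := expand_contract 2 hd two_ne_zero
  set r := contract 2 (Polynomial.C α * p + Polynomial.C β * q)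
  have h2 : Polynomial.C (α^2) * F + Polynomial.C (β^2) * G = r ^ 2 := by
    apply expand_injective (R := k) (n := 2) two_pos
    rw [map_pow (expand k 2) r, hr, add_pow_char]
    simp only [map_add, map_mul, expand_C, ← hp, ← hq, mul_pow, map_pow]
  have hmem : r ^ 2 ∈ squaresSubmodule k := by
    rw [← map_frobenius_expand (p := 2), map_expand]
    generalize r.map (frobenius k 2) = s
    show _ ∈ Algebra.adjoin k {(X : Polynomial k) ^ 2}
    rw [expand_eq_sum, Polynomial.sum]
    refine Subalgebra.sum_mem _ fun i _ => ?_
    rw [← Polynomial.smul_eq_C_mul]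
    exact Subalgebra.smul_mem _ (Subalgebra.pow_mem _
      (Algebra.subset_adjoin (Set.mem_singleton _)) _) _
  rw [LinearIndependent.pair_iff] at h
  have := h (α^2) (β^2) (by
    have : sqClass (Polynomial.C (α^2) * F + Polynomial.C (β^2) * G) = 0 := by
      rw [h2]; exact (Submodule.Quotient.mk_eq_zero _).2 hmem
    rw [← this]
    simp only [sqClass, ← Polynomial.smul_eq_C_mul]
    rfl)
  simpa using this

lemma coprime_even {k : Type*} [Field k] [CharP k 2] {g h : Polynomial k}
    (hc : IsCoprime g h) (hd : derivative (g * h) = 0) :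
    derivative g = 0 := by
  have h1 : g ∣ derivative g := by
    apply hc.dvd_of_dvd_mul_right
    rw [derivative_mul] at hd
    rw [eq_neg_of_add_eq_zero_left hd]
    exact (dvd_mul_right _ _).neg_right
  by_contra hne
  have := degree_le_of_dvd h1 hne
  have h3 : g ≠ 0 := by rintro rfl; simp at hne
  exact absurd (degree_derivative_lt h3) (not_lt.2 this)

set_option maxHeartbeats 4000000 in
lemma rows {k : Type*} [Field k] (g11 g12 g21 g22 : Polynomial k)
    (c : LaurentPolynomial k) (a : Fin 16 → k) :
    (fun i => ∑ j : Fin 16, a j • bigMatrixEven g11 g12 g21 g22 c i j) =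
    ![toLaurent (Polynomial.C (a 0) + Polynomial.C (a 1) * (g11*g21) + Polynomial.C (a 2) * (g12*g22)) + a 3 • c,
      toLaurent (Polynomial.C (a 1) + Polynomial.C (a 3) * (g12*g22)),
      toLaurent (Polynomial.C (a 2) + Polynomial.C (a 3) * (g11*g21)),
      toLaurent (Polynomial.C (a 3)),
      toLaurent (Polynomial.C (a 4) * g11 + Polynomial.C (a 6) * g21 + (Polynomial.C (a 13) * g11 + Polynomial.C (a 15) * g21) * (g12*g22)),
      toLaurent (Polynomial.C (a 5) * g11 + Polynomial.C (a 7) * g21 + (Polynomial.C (a 12) * g11 + Polynomial.C (a 14) * g21) * (g11*g21)),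
      toLaurent (Polynomial.C (a 4) * g12 + Polynomial.C (a 6) * g22 + (Polynomial.C (a 13) * g12 + Polynomial.C (a 15) * g22) * (g12*g22)),
      toLaurent (Polynomial.C (a 5) * g12 + Polynomial.C (a 7) * g22 + (Polynomial.C (a 12) * g12 + Polynomial.C (a 14) * g22) * (g11*g21)),
      toLaurent (Polynomial.C (a 8) * (g11*g11) + Polynomial.C (a 9) * (g11*g21) + Polynomial.C (a 10) * (g21*g11) + Polynomial.C (a 11) * (g21*g21)),
      toLaurent (Polynomial.C (a 8) * (g11*g12) + Polynomial.C (a 9) * (g11*g22) + Polynomial.C (a 10) * (g21*g12) + Polynomial.C (a 11) * (g21*g22)),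
      toLaurent (Polynomial.C (a 8) * (g12*g11) + Polynomial.C (a 9) * (g12*g21) + Polynomial.C (a 10) * (g22*g11) + Polynomial.C (a 11) * (g22*g21)),
      toLaurent (Polynomial.C (a 8) * (g12*g12) + Polynomial.C (a 9) * (g12*g22) + Polynomial.C (a 10) * (g22*g12) + Polynomial.C (a 11) * (g22*g22)),
      toLaurent (Polynomial.C (a 12) * g11 + Polynomial.C (a 14) * g21),
      toLaurent (Polynomial.C (a 13) * g11 + Polynomial.C (a 15) * g21),
      toLaurent (Polynomial.C (a 12) * g12 + Polynomial.C (a 14) * g22),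
      toLaurent (Polynomial.C (a 13) * g12 + Polynomial.C (a 15) * g22)] := by
  ext1 i
  fin_cases i <;>
  simp [Fin.sum_univ_succ, bigMatrixEven, kron2, Matrix.one_fin_two, LaurentPolynomial.smul_eq_C_mul, Fin.succ] <;> ring


lemma gdet {k : Type*} [Field k] [CharP k 2]
    {f11 f12 f21 f22 g11 g12 g21 g22 : Polynomial k}
    (hdet : f11 * f22 + f12 * f21 = 1)
    (hg11 : g11 ^ 2 = Polynomial.expand k 2 f11)
    (hg12 : g12 ^ 2 = Polynomial.expand k 2 f12)
    (hg21 : g21 ^ 2 = Polynomial.expand k 2 f21)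
    (hg22 : g22 ^ 2 = Polynomial.expand k 2 f22) : g11 * g22 + g12 * g21 = 1 := by
  have h : (g11 * g22 + g12 * g21) ^ 2 = 1 ^ 2 := by
    rw [add_pow_char, mul_pow, mul_pow, hg11, hg12, hg21, hg22, ← map_mul, ← map_mul, ← map_add,
      hdet, map_one, one_pow]
  have h2 : (g11 * g22 + g12 * g21 - 1) ^ 2 = 0 := by
    rw [sub_pow_char, h, sub_self]
  exact sub_eq_zero.1 (pow_eq_zero_iff two_ne_zero |>.1 h2)

/-- The parametrization of the solution space. -/
def solMap (k : Type*) [Field k] : (k × k) →ₗ[k] (Fin 16 → k) where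
  toFun x := ![x.1, 0, 0, 0, 0, 0, 0, 0, 0, x.2, x.2, 0, 0, 0, 0, 0]
  map_add' x y := by ext i; fin_cases i <;> simp
  map_smul' r x := by ext i; fin_cases i <;> simp

lemma solMap_inj (k : Type*) [Field k] : Function.Injective (solMap k) := by
  intro x y h
  have h0 := congrFun h 0
  have h9 := congrFun h 9
  exact Prod.ext h0 h9

lemma block3 {k : Type*} [Field k] [IsAlgClosed k] [CharP k 2]
    {f11 f12 f21 f22 g11 g12 g21 g22 : Polynomial k}
    (h2 : LinearIndependent k ![sqClass f11, sqClass f21] ∨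
          LinearIndependent k ![sqClass f12, sqClass f22])
    (hg11 : g11 ^ 2 = Polynomial.expand k 2 f11)
    (hg12 : g12 ^ 2 = Polynomial.expand k 2 f12)
    (hg21 : g21 ^ 2 = Polynomial.expand k 2 f21)
    (hg22 : g22 ^ 2 = Polynomial.expand k 2 f22)
    (hd : g11 * g22 + g12 * g21 = 1) (α β : k)
    (h : derivative (Polynomial.C α * (g11 * g12) + Polynomial.C β * (g21 * g22)) = 0) :
    α = 0 ∧ β = 0 := by
  obtain ⟨a, ha⟩ := IsAlgClosed.exists_pow_nat_eq α two_pos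
  obtain ⟨b, hb⟩ := IsAlgClosed.exists_pow_nat_eq β two_pos
  by_contra hne
  have h2' : (2 : Polynomial k) = 0 := CharTwo.two_eq_zero
  set g := Polynomial.C a * g11 + Polynomial.C b * g21 with hg
  set e := Polynomial.C a * g12 + Polynomial.C b * g22 with he
  have hc : IsCoprime g e := by
    by_cases ha0 : a = 0
    · have hb0 : b ≠ 0 := by
        rintro rfl
        apply hne
        rw [← ha, ← hb, ha0]; simp
      have hi : Polynomial.C b⁻¹ * Polynomial.C b = 1 := by
        rw [← Polynomial.C_mul, inv_mul_cancel₀ hb0, Polynomial.C_1]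
      refine ⟨Polynomial.C b⁻¹ * g12, Polynomial.C b⁻¹ * g11, ?_⟩
      rw [hg, he, ha0, Polynomial.C_0]
      linear_combination (Polynomial.C b⁻¹ * Polynomial.C b) * hd + hi
    · have hi : Polynomial.C a⁻¹ * Polynomial.C a = 1 := by
        rw [← Polynomial.C_mul, inv_mul_cancel₀ ha0, Polynomial.C_1]
      refine ⟨Polynomial.C a⁻¹ * g22, Polynomial.C a⁻¹ * g21, ?_⟩
      rw [hg, he]
      linear_combination (Polynomial.C a⁻¹ * Polynomial.C a) * hd + hi +
        (Polynomial.C a⁻¹ * Polynomial.C b * g21 * g22) * h2'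
  have hprod : g * e = (Polynomial.C α * (g11 * g12) + Polynomial.C β * (g21 * g22))
      + Polynomial.C (a * b) := by
    rw [hg, he, ← ha, ← hb]
    simp only [Polynomial.C_mul, Polynomial.C_pow]
    linear_combination (Polynomial.C a * Polynomial.C b) * hd
  have hge : derivative (g * e) = 0 := by
    rw [hprod, derivative_add, h, derivative_C, add_zero]
  have hg0 := coprime_even hc hge
  have he0 := coprime_even hc.symm (by rwa [mul_comm])
  have hab : a = 0 ∧ b = 0 := by
    rcases h2 with h2 | h2
    · exact indep h2 hg11 hg21 a b hg0
    · exact indep h2 hg12 hg22 a b he0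
  apply hne
  rw [← ha, ← hb, hab.1, hab.2]; simp

/-- in characteristic 2, under the stated independence hypotheses on the `fᵢⱼ`
with `f₁₁f₂₂ + f₁₂f₂₁ = 1`, and with `gᵢⱼ(t)² = fᵢⱼ(t²)`, the space of vectors `a ∈ k¹⁶`
such that every entry of `A(c)·a` lies in `k[t², t⁻²]` is 2-dimensional. -/
theorem statement5 {k : Type*} [Field k] [IsAlgClosed k] [CharP k 2]
    (f11 f12 f21 f22 : Polynomial k)
    (hdet : f11 * f22 + f12 * f21 = 1)
    (h1 : LinearIndependent k ![sqClass (f11 * f21), sqClass (f12 * f22)])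
    (h2 : LinearIndependent k ![sqClass f11, sqClass f21] ∨
          LinearIndependent k ![sqClass f12, sqClass f22])
    (g11 g12 g21 g22 : Polynomial k)
    (hg11 : g11 ^ 2 = Polynomial.expand k 2 f11)
    (hg12 : g12 ^ 2 = Polynomial.expand k 2 f12)
    (hg21 : g21 ^ 2 = Polynomial.expand k 2 f21)
    (hg22 : g22 ^ 2 = Polynomial.expand k 2 f22)
    (c : LaurentPolynomial k) :
    ∃ W : Submodule k (Fin 16 → k),
      (W : Set (Fin 16 → k)) =
        {a | ∀ i : Fin 16,
          (∑ j : Fin 16, a j • bigMatrixEven g11 g12 g21 g22 c i j) ∈ evenLaurentSubmodule k}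
        ∧ Module.finrank k W = 2 := by
  have hd := gdet hdet hg11 hg12 hg21 hg22
  have h2' : (2 : Polynomial k) = 0 := CharTwo.two_eq_zero
  have key : ∀ α β : k, derivative (Polynomial.C α * (g11 * g21) + Polynomial.C β * (g12 * g22)) = 0
      → α = 0 ∧ β = 0 := fun α β h =>
    indep h1 (by rw [mul_pow, hg11, hg21, map_mul]) (by rw [mul_pow, hg12, hg22, map_mul]) α β h
  have key2 : ∀ α β : k, derivative (Polynomial.C α * g11 + Polynomial.C β * g21) = 0 →
      derivative (Polynomial.C α * g12 + Polynomial.C β * g22) = 0 → α = 0 ∧ β = 0 := by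
    intro α β u v
    rcases h2 with h2 | h2
    · exact indep h2 hg11 hg21 α β u
    · exact indep h2 hg12 hg22 α β v
  have key3 := block3 h2 hg11 hg12 hg21 hg22 hd
  refine ⟨LinearMap.range (solMap k), ?_, ?_⟩
  · ext a
    have hr := fun i => congrFun (rows g11 g12 g21 g22 c a) i
    simp only [Set.mem_ofPred_eq, SetLike.mem_coe, LinearMap.mem_range, hr]
    constructor
    · rintro ⟨x, rfl⟩ i
      have hC : ∀ r : k, toLaurent (Polynomial.C r) ∈ evenLaurentSubmodule k := by
        intro r
        rw [toLaurent_C]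
        exact Subalgebra.algebraMap_mem _ r
      have hC0 : (0 : LaurentPolynomial k) ∈ evenLaurentSubmodule k := Submodule.zero_mem _
      have e0 : ∀ p : Polynomial k, p + p = 0 := fun p => by
        linear_combination p * h2'
      have m1 := hC x.1
      have m2 : toLaurent (Polynomial.C x.2 * (g11 * g22) + Polynomial.C x.2 * (g21 * g12)) ∈
          evenLaurentSubmodule k := by
        convert hC x.2 using 2
        linear_combination (Polynomial.C x.2) * hd
      have m3 : toLaurent (Polynomial.C x.2 * (g12 * g21) + Polynomial.C x.2 * (g22 * g11)) ∈
          evenLaurentSubmodule k := by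
        convert hC x.2 using 2
        linear_combination (Polynomial.C x.2) * hd
      have m4 : toLaurent (Polynomial.C x.2 * (g11 * g21) + Polynomial.C x.2 * (g21 * g11)) ∈
          evenLaurentSubmodule k := by
        rw [mul_comm g21 g11, e0, map_zero]; exact hC0
      have m5 : toLaurent (Polynomial.C x.2 * (g12 * g22) + Polynomial.C x.2 * (g22 * g12)) ∈
          evenLaurentSubmodule k := by
        rw [mul_comm g22 g12, e0, map_zero]; exact hC0
      have s0 : solMap k x 0 = x.1 := rfl
      have s1 : solMap k x 1 = 0 := rfl
      have s2 : solMap k x 2 = 0 := rfl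
      have s3 : solMap k x 3 = 0 := rfl
      have s4 : solMap k x 4 = 0 := rfl
      have s5 : solMap k x 5 = 0 := rfl
      have s6 : solMap k x 6 = 0 := rfl
      have s7 : solMap k x 7 = 0 := rfl
      have s8 : solMap k x 8 = 0 := rfl
      have s9 : solMap k x 9 = x.2 := rfl
      have s10 : solMap k x 10 = x.2 := rfl
      have s11 : solMap k x 11 = 0 := rfl
      have s12 : solMap k x 12 = 0 := rfl
      have s13 : solMap k x 13 = 0 := rfl
      have s14 : solMap k x 14 = 0 := rfl
      have s15 : solMap k x 15 = 0 := rfl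
      simp only [s0, s1, s2, s3, s4, s5, s6, s7, s8, s9, s10, s11, s12, s13, s14, s15,
        Polynomial.C_0, zero_mul, add_zero, zero_add, zero_smul]
      have hz : toLaurent (0 : Polynomial k) ∈ evenLaurentSubmodule k := by
        rw [map_zero]; exact hC0
      fin_cases i
      · exact m1
      · exact hz
      · exact hz
      · exact hz
      · exact hz
      · exact hz
      · exact hz
      · exact hz
      · exact m4
      · exact m2
      · exact m3
      · exact m5
      · exact hz
      · exact hz
      · exact hz
      · exact hz
    · intro h
      have q1 := deriv_zero_of_even (h 1)
      obtain ⟨-, a3⟩ := key 0 (a 3) (by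
        simpa only [Polynomial.C_0, zero_mul, zero_add, derivative_add, derivative_C] using q1)
      have q0 := h 0
      simp only [Matrix.cons_val_zero, a3, zero_smul, add_zero] at q0
      obtain ⟨a1, a2⟩ := key (a 1) (a 2) (by
        have := deriv_zero_of_even q0
        simpa only [add_assoc, zero_add, derivative_add, derivative_C] using this)
      obtain ⟨a12, a14⟩ := key2 _ _ (deriv_zero_of_even (h 12)) (deriv_zero_of_even (h 14))
      obtain ⟨a13, a15⟩ := key2 _ _ (deriv_zero_of_even (h 13)) (deriv_zero_of_even (h 15))
      have z4 := deriv_zero_of_even (h 4)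
      have z5 := deriv_zero_of_even (h 5)
      have z6 := deriv_zero_of_even (h 6)
      have z7 := deriv_zero_of_even (h 7)
      rw [a13, a15, Polynomial.C_0, zero_mul, zero_mul, add_zero, zero_mul, add_zero] at z4 z6
      rw [a12, a14, Polynomial.C_0, zero_mul, zero_mul, add_zero, zero_mul, add_zero] at z5 z7
      obtain ⟨a4, a6⟩ := key2 _ _ z4 z6
      obtain ⟨a5, a7⟩ := key2 _ _ z5 z7
      have z8 := deriv_zero_of_even (h 8)
      have z9 := deriv_zero_of_even (h 9)
      obtain ⟨a910, -⟩ := key (a 9 + a 10) 0 (by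
        rw [← z8]
        simp only [derivative_add, derivative_mul, derivative_C, Polynomial.C_0, Polynomial.C_add,
          Polynomial.derivative_zero]
        linear_combination (- Polynomial.C (a 8) * g11 * derivative g11
          - Polynomial.C (a 11) * g21 * derivative g21) * h2')
      have a10 : a 10 = a 9 := by
        have t : (2 : k) = 0 := CharTwo.two_eq_zero
        linear_combination a910 - a 9 * t
      rw [a10] at z9
      obtain ⟨a8, a11⟩ := key3 (a 8) (a 11) (by
        have e : Polynomial.C (a 8) * (g11 * g12) + Polynomial.C (a 9) * (g11 * g22)
            + Polynomial.C (a 9) * (g21 * g12) + Polynomial.C (a 11) * (g21 * g22)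
            = Polynomial.C (a 8) * (g11 * g12) + Polynomial.C (a 11) * (g21 * g22)
              + Polynomial.C (a 9) := by
          linear_combination Polynomial.C (a 9) * hd
        have z9' : derivative (Polynomial.C (a 8) * (g11 * g12) + Polynomial.C (a 9) * (g11 * g22)
            + Polynomial.C (a 9) * (g21 * g12) + Polynomial.C (a 11) * (g21 * g22)) = 0 := z9
        rw [e, derivative_add, derivative_C, add_zero] at z9'
        exact z9')
      refine ⟨(a 0, a 9), ?_⟩
      ext i
      fin_cases i
      · rfl
      · exact a1.symm
      · exact a2.symm
      · exact a3.symm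
      · exact a4.symm
      · exact a5.symm
      · exact a6.symm
      · exact a7.symm
      · exact a8.symm
      · rfl
      · exact a10.symm
      · exact a11.symm
      · exact a12.symm
      · exact a13.symm
      · exact a14.symm
      · exact a15.symm
  · rw [LinearMap.finrank_range_of_inj (solMap_inj k)]
    simp
end

section
/- Let k be an algebraically closed field of characteristic p > 0, let n ≥ 1 be an integer, and let g₁, …, g_n ∈ k[t]. For a family of scalars a = (a_J) ∈ k^{p^n} indexed by multi-indices J = (J₁,…,J_n) with 0 ≤ J_i ≤ p−1, consider the element P_a := Σ_J a_J · ∏_{i=1}^n (g_i(t) + Z_i)^{J_i} of the quotient ring k[t][Z₁,…,Z_n]/(Z₁^p,…,Z_n^p), and write P_a = Σ_L c_L(t) · Z₁^{L₁}⋯Z_n^{L_n} with coefficients c_L(t) ∈ k[t], the sum over multi-indices L with 0 ≤ L_i ≤ p−1. Then the k-vector space { a ∈ k^{p^n} : c_L(t) ∈ k[t^p] for every L } has dimension exactly 1 if and only if the images of g₁, …, g_n in the quotient k-vector space k[t]/k[t^p] are linearly independent over k. -/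
open Polynomial

/-- The `k`-subspace `k[t^p]` of `k[t]`, i.e. the subalgebra of all polynomials in `t^p`,
viewed as a `k`-submodule. -/
noncomputable def pPowerSubmodule (k : Type*) [CommRing k] (p : ℕ) :
    Submodule k (Polynomial k) :=
  Subalgebra.toSubmodule (Algebra.adjoin k {(X : Polynomial k) ^ p})


namespace S7

lemma mem_pPower {k : Type*} [Field k] {p : ℕ} [Fact p.Prime] [CharP k p] (f : Polynomial k) :
    f ∈ pPowerSubmodule k p ↔ derivative f = 0 := by
  have hp : p ≠ 0 := (Fact.out : p.Prime).ne_zero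
  unfold pPowerSubmodule
  rw [Subalgebra.mem_toSubmodule, Algebra.adjoin_singleton_eq_range_aeval, AlgHom.mem_range]
  constructor
  · rintro ⟨q, rfl⟩
    have h : aeval ((X : k[X]) ^ p) q = expand k p q := by
      rw [expand_eq_comp_X_pow]; rfl
    rw [h, derivative_expand]
    simp
  · intro h
    refine ⟨contract p f, ?_⟩
    rw [← comp_eq_aeval, ← expand_eq_comp_X_pow, expand_contract p h hp]

noncomputable def D {k : Type*} [Field k] {n : ℕ} (q : MvPolynomial (Fin n) k[X]) :
    MvPolynomial (Fin n) k[X] :=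
  ∑ m ∈ q.support, MvPolynomial.monomial m (derivative (MvPolynomial.coeff m q))

section
variable {k : Type*} [Field k] {n : ℕ}

lemma coeff_D (q : MvPolynomial (Fin n) k[X]) (m : Fin n →₀ ℕ) :
    MvPolynomial.coeff m (D q) = derivative (MvPolynomial.coeff m q) := by
  classical
  simp only [D, MvPolynomial.coeff_sum, MvPolynomial.coeff_monomial]
  rw [Finset.sum_ite_eq']
  split_ifs with h
  · rfl
  · rw [MvPolynomial.notMem_support_iff.mp h]; simp

lemma D_add (q r : MvPolynomial (Fin n) k[X]) : D (q + r) = D q + D r := by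
  ext1 m; simp [coeff_D]

lemma D_mul (q r : MvPolynomial (Fin n) k[X]) : D (q * r) = D q * r + q * D r := by
  classical
  ext1 m
  simp only [coeff_D, MvPolynomial.coeff_mul, MvPolynomial.coeff_add, derivative_sum,
    derivative_mul, Finset.sum_add_distrib]

lemma D_C (f : k[X]) : D (MvPolynomial.C f : MvPolynomial (Fin n) k[X])
    = MvPolynomial.C (derivative f) := by
  classical
  ext1 m
  simp only [coeff_D, MvPolynomial.coeff_C]
  split_ifs <;> simp

lemma D_X (i : Fin n) : D (MvPolynomial.X i : MvPolynomial (Fin n) k[X]) = 0 := by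
  classical
  ext1 m
  simp only [coeff_D, MvPolynomial.coeff_X', MvPolynomial.coeff_zero]
  split_ifs <;> simp

noncomputable def phi (g : Fin n → k[X]) :
    MvPolynomial (Fin n) k →ₐ[k] MvPolynomial (Fin n) k[X] :=
  MvPolynomial.aeval (fun i => MvPolynomial.C (g i) + MvPolynomial.X i)

lemma phi_C (g : Fin n → k[X]) (c : k) :
    phi g (MvPolynomial.C c) = MvPolynomial.C (Polynomial.C c) := by
  simp only [phi, MvPolynomial.aeval_C]; rfl

lemma phi_X (g : Fin n → k[X]) (i : Fin n) :
    phi g (MvPolynomial.X i) = MvPolynomial.C (g i) + MvPolynomial.X i := by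
  simp [phi]

lemma D_phi (g : Fin n → k[X]) (F : MvPolynomial (Fin n) k) :
    D (phi g F) = ∑ i, MvPolynomial.C (derivative (g i)) * phi g (MvPolynomial.pderiv i F) := by
  classical
  induction F using MvPolynomial.induction_on with
  | C c => simp [phi_C, D_C]
  | add p q hp hq => simp [D_add, hp, hq, mul_add, Finset.sum_add_distrib]
  | mul_X p j hp =>
    rw [map_mul, D_mul, hp, phi_X, D_add, D_C, D_X, add_zero]
    simp only [MvPolynomial.pderiv_mul, map_add, map_mul, phi_X, mul_add,
      Finset.sum_add_distrib, Finset.sum_mul, MvPolynomial.pderiv_X, ← mul_assoc]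
    congr 1
    rw [Finset.sum_eq_single j]
    · simp [mul_comm]
    · intro b _ hb
      rw [Pi.single_eq_of_ne hb.symm]; simp
    · simp

noncomputable def shift (h : Fin n → k[X]) :
    MvPolynomial (Fin n) k[X] →ₐ[k[X]] MvPolynomial (Fin n) k[X] :=
  MvPolynomial.aeval (fun i => MvPolynomial.X i + MvPolynomial.C (h i))

lemma shift_C (h : Fin n → k[X]) (c : k[X]) : shift h (MvPolynomial.C c) = MvPolynomial.C c := by
  simp only [shift, MvPolynomial.aeval_C]; rfl

lemma shift_X (h : Fin n → k[X]) (i : Fin n) :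
    shift h (MvPolynomial.X i) = MvPolynomial.X i + MvPolynomial.C (h i) := by
  simp [shift]

lemma shift_phi (g : Fin n → k[X]) (F : MvPolynomial (Fin n) k) :
    shift (fun i => - g i) (phi g F) = MvPolynomial.map Polynomial.C F := by
  induction F using MvPolynomial.induction_on with
  | C c => simp [phi_C, shift_C]
  | add p q hp hq => simp [hp, hq]
  | mul_X p j hp => simp [hp, phi_X, shift_X, shift_C]

lemma shift_map (g : Fin n → k[X]) (F : MvPolynomial (Fin n) k) :
    shift g (MvPolynomial.map Polynomial.C F) = phi g F := by
  induction F using MvPolynomial.induction_on with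
  | C c => simp [phi_C, shift_C]
  | add p q hp hq => simp [hp, hq]
  | mul_X p j hp => simp [hp, phi_X, shift_X, add_comm]

lemma D_phi_eq_zero_iff (g : Fin n → k[X]) (F : MvPolynomial (Fin n) k) :
    D (phi g F) = 0 ↔ ∀ m, ∑ i, MvPolynomial.coeff m (MvPolynomial.pderiv i F) •
      derivative (g i) = 0 := by
  have h1 : D (phi g F) = 0 ↔ ∑ i, MvPolynomial.C (derivative (g i)) *
      MvPolynomial.map Polynomial.C (MvPolynomial.pderiv i F) = 0 := by
    rw [D_phi]
    constructor
    · intro h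
      have := congrArg (shift (fun i => - g i)) h
      simpa [map_sum, shift_C, shift_phi] using this
    · intro h
      have := congrArg (shift g) h
      simpa [map_sum, shift_C, shift_map] using this
  rw [h1, MvPolynomial.ext_iff]
  refine forall_congr' fun m => ?_
  simp only [MvPolynomial.coeff_sum, MvPolynomial.coeff_C_mul, MvPolynomial.coeff_map,
    Polynomial.smul_eq_C_mul, MvPolynomial.coeff_zero]
  simp only [mul_comm]

noncomputable def emb {p : ℕ} (J : Fin n → Fin p) : Fin n →₀ ℕ :=
  Finsupp.equivFunOnFinite.symm (fun i => (J i : ℕ))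

lemma emb_inj {p : ℕ} : Function.Injective (emb : (Fin n → Fin p) → (Fin n →₀ ℕ)) := by
  intro J K h
  funext i
  have := DFunLike.congr_fun h i
  exact Fin.ext (by simpa [emb] using this)

noncomputable def FF {p : ℕ} (a : (Fin n → Fin p) → k) : MvPolynomial (Fin n) k :=
  ∑ J, MvPolynomial.monomial (emb J) (a J)

lemma coeff_FF {p : ℕ} (a : (Fin n → Fin p) → k) (J : Fin n → Fin p) :
    MvPolynomial.coeff (emb J) (FF a) = a J := by
  classical
  simp [FF, MvPolynomial.coeff_sum, MvPolynomial.coeff_monomial, emb_inj.eq_iff]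

lemma phi_FF {p : ℕ} (g : Fin n → k[X]) (a : (Fin n → Fin p) → k) :
    phi g (FF a) = ∑ J : Fin n → Fin p, a J • ∏ i : Fin n,
                (MvPolynomial.C (g i) +
                  (MvPolynomial.X i : MvPolynomial (Fin n) (Polynomial k))) ^ (J i : ℕ) := by
  rw [FF, map_sum]
  refine Finset.sum_congr rfl fun J _ => ?_
  rw [phi, MvPolynomial.aeval_monomial, Algebra.smul_def, Finsupp.prod_fintype _ _ (by simp)]
  rfl

lemma mem_iff {p : ℕ} [Fact p.Prime] [CharP k p] (g : Fin n → k[X]) (a : (Fin n → Fin p) → k) :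
    (∀ L : Fin n → ℕ,
          MvPolynomial.coeff (Finsupp.equivFunOnFinite.symm L)
            (∑ J : Fin n → Fin p, a J •
              ∏ i : Fin n,
                (MvPolynomial.C (g i) +
                  (MvPolynomial.X i : MvPolynomial (Fin n) (Polynomial k))) ^ (J i : ℕ))
            ∈ pPowerSubmodule k p) ↔
    ∀ m, ∑ i, MvPolynomial.coeff m (MvPolynomial.pderiv i (FF a)) • derivative (g i) = 0 := by
  rw [← D_phi_eq_zero_iff, ← phi_FF, MvPolynomial.ext_iff]
  simp only [mem_pPower, coeff_D, MvPolynomial.coeff_zero]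
  exact ⟨fun h m => by simpa using h (Finsupp.equivFunOnFinite m), fun h L => h _⟩

lemma li_iff {p : ℕ} [Fact p.Prime] [CharP k p] (g : Fin n → k[X]) :
    LinearIndependent k
        (fun i : Fin n => Submodule.Quotient.mk (p := pPowerSubmodule k p) (g i)) ↔
    ∀ c : Fin n → k, ∑ i, c i • derivative (g i) = 0 → ∀ i, c i = 0 := by
  rw [Fintype.linearIndependent_iff]
  refine forall_congr' fun c => ?_
  have : ∑ i, c i • Submodule.Quotient.mk (p := pPowerSubmodule k p) (g i)
      = Submodule.Quotient.mk (p := pPowerSubmodule k p) (∑ i, c i • g i) := by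
    simp only [← Submodule.mkQ_apply, map_sum, map_smul]
  rw [this, Submodule.Quotient.mk_eq_zero, mem_pPower]
  simp [derivative_sum, derivative_smul]

end

end S7

open S7

/-- for `g₁, …, g_n ∈ k[t]`, write
`P_a = Σ_J a_J ∏ᵢ (gᵢ(t) + Zᵢ)^{Jᵢ} = Σ_L c_L(t) Z^L` (a computation in
`k[t][Z₁,…,Z_n]` which is faithful to the quotient `k[t][Z]/(Z₁^p,…,Z_n^p)` since all
`Z`-exponents occurring are `< p`).  Then the space of `a ∈ k^{p^n}` with all
`c_L(t) ∈ k[t^p]` is 1-dimensional iff the images of `g₁,…,g_n` in `k[t]/k[t^p]` are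
linearly independent over `k`. -/
theorem statement7 {k : Type*} [Field k] [IsAlgClosed k] {p : ℕ} [Fact p.Prime] [CharP k p]
    (n : ℕ) (hn : 1 ≤ n) (g : Fin n → Polynomial k) :
    (∃ W : Submodule k ((Fin n → Fin p) → k),
      (W : Set ((Fin n → Fin p) → k)) =
        {a | ∀ L : Fin n → ℕ,
          MvPolynomial.coeff (Finsupp.equivFunOnFinite.symm L)
            (∑ J : Fin n → Fin p, a J •
              ∏ i : Fin n,
                (MvPolynomial.C (g i) +
                  (MvPolynomial.X i : MvPolynomial (Fin n) (Polynomial k))) ^ (J i : ℕ))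
            ∈ pPowerSubmodule k p}
        ∧ Module.finrank k W = 1)
    ↔ LinearIndependent k
        (fun i : Fin n => Submodule.Quotient.mk (p := pPowerSubmodule k p) (g i)) := by
  classical
  have hp : p.Prime := Fact.out
  haveI : NeZero p := ⟨hp.ne_zero⟩
  simp only [mem_iff]
  rw [li_iff]
  have h0 : ∀ i : Fin n, MvPolynomial.pderiv i
      (FF (Pi.single (0 : Fin n → Fin p) (1 : k))) = 0 := by
    intro i
    have : FF (Pi.single (0 : Fin n → Fin p) (1 : k)) = MvPolynomial.C 1 := by
      rw [FF, Finset.sum_eq_single (0 : Fin n → Fin p)]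
      · have : emb (0 : Fin n → Fin p) = 0 := by ext i; simp [emb]
        rw [this]; simp
      · intro b _ hb; rw [Pi.single_eq_of_ne hb]; simp
      · simp
    rw [this, MvPolynomial.pderiv_C]
  have hne : (Pi.single (0 : Fin n → Fin p) (1 : k) : (Fin n → Fin p) → k) ≠ 0 := by
    intro h
    have := congrFun h 0
    simp at this
  constructor
  · rintro ⟨W, hW, hd⟩ c hc
    have m0 : (Pi.single (0 : Fin n → Fin p) (1 : k) : (Fin n → Fin p) → k) ∈ W := by
      rw [← SetLike.mem_coe, hW]
      intro m
      simp [h0]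
    let e : Fin n → Fin n → Fin p := fun i => Pi.single i ⟨1, hp.one_lt⟩
    have he : ∀ i, emb (e i) = Finsupp.single i 1 := by
      intro i
      ext j
      by_cases hij : j = i
      · subst hij; simp [emb, e]
      · simp [emb, e, hij, Finsupp.single_apply, Ne.symm hij]
    have heinj : Function.Injective e := by
      intro i j hij
      have := congrArg emb hij
      rw [he, he] at this
      exact Finsupp.single_left_injective one_ne_zero this
    let w : (Fin n → Fin p) → k := ∑ i, c i • Pi.single (e i) (1 : k)
    have hw : ∀ i, w (e i) = c i := by
      intro i
      simp [w, Finset.sum_apply, Pi.single_apply, heinj.eq_iff]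
    have he0 : ∀ i, e i ≠ 0 := by
      intro i h
      have := congrArg emb h
      rw [he] at this
      have := DFunLike.congr_fun this i
      simp [emb] at this
    have hFw : FF w = ∑ i, MvPolynomial.C (c i) * MvPolynomial.X i := by
      have : ∀ J, MvPolynomial.monomial (emb J) (w J) =
          ∑ i, if J = e i then MvPolynomial.C (c i) * MvPolynomial.X i else 0 := by
        intro J
        simp only [w, Finset.sum_apply, map_sum]
        refine Finset.sum_congr rfl fun i _ => ?_
        split_ifs with h
        · subst h
          rw [he]
          simp [MvPolynomial.C_mul_X_eq_monomial]
        · simp [Pi.single_apply, h]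
      rw [FF, Finset.sum_congr rfl fun J _ => this J, Finset.sum_comm]
      simp
    have mw : w ∈ W := by
      rw [← SetLike.mem_coe, hW]
      intro m
      have hpd : ∀ i, MvPolynomial.pderiv i (FF w) = MvPolynomial.C (c i) := by
        intro i
        rw [hFw, map_sum]
        rw [Finset.sum_eq_single i]
        · simp [MvPolynomial.pderiv_C_mul]
        · intro j _ hj
          rw [MvPolynomial.pderiv_C_mul, MvPolynomial.pderiv_X_of_ne hj, mul_zero]
        · simp
      simp only [hpd, MvPolynomial.coeff_C]
      split_ifs
      · exact hc
      · simp
    obtain ⟨d, hdw⟩ := (finrank_eq_one_iff_of_nonzero'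
      (⟨_, m0⟩ : W) (by simpa [Subtype.ext_iff] using hne)).mp hd ⟨w, mw⟩
    have hdw' := congrArg Subtype.val hdw
    intro i
    rw [← hw i]
    have := congrFun hdw' (e i)
    refine this.symm.trans ?_
    simp [Pi.single_apply, he0 i]
  · intro hli
    refine ⟨Submodule.span k {Pi.single (0 : Fin n → Fin p) (1 : k)}, ?_,
      finrank_span_singleton hne⟩
    ext a
    simp only [SetLike.mem_coe, Submodule.mem_span_singleton, Set.mem_setOf_eq]
    constructor
    · rintro ⟨c, rfl⟩ m
      have : FF (c • (Pi.single (0 : Fin n → Fin p) (1 : k) : (Fin n → Fin p) → k)) =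
          c • FF (Pi.single (0 : Fin n → Fin p) (1 : k)) := by
        simp [FF, Finset.smul_sum, MvPolynomial.smul_monomial]
      rw [this]
      simp [h0]
    · intro h
      refine ⟨a 0, ?_⟩
      funext J
      by_cases hJ : J = 0
      · subst hJ; simp
      · obtain ⟨i, hi⟩ := Function.ne_iff.mp hJ
        have hi' : (J i : ℕ) ≠ 0 := fun h => hi (Fin.ext (by simpa using h))
        have hc := hli _ (h (emb J - Finsupp.single i 1)) i
        rw [MvPolynomial.coeff_pderiv] at hc
        have hle : Finsupp.single i 1 ≤ emb J := by
          rw [Finsupp.single_le_iff]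
          simp only [emb, Finsupp.equivFunOnFinite_symm_apply_apply]
          omega
        rw [tsub_add_cancel_of_le hle, coeff_FF] at hc
        have hcast : (((emb J - Finsupp.single i 1 : Fin n →₀ ℕ) i : ℕ) : k) + 1 = ((J i : ℕ) : k) := by
          rw [← Nat.cast_succ]
          congr 1
          simp only [emb, Finsupp.tsub_apply, Finsupp.equivFunOnFinite_symm_apply_apply,
            Finsupp.single_eq_same]
          omega
        rw [hcast] at hc
        have hnz : ((J i : ℕ) : k) ≠ 0 := by
          rw [Ne, CharP.cast_eq_zero_iff k p]
          intro hdvd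
          exact absurd (Nat.le_of_dvd (Nat.pos_of_ne_zero hi') hdvd) (not_le.mpr (J i).isLt)
        rcases mul_eq_zero.mp hc with h | h
        · rw [h]; simp [Pi.single_apply, hJ]
        · exact absurd h hnz
end
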